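/- arXiv:0712.3865 — 2 statements merged into one kernel-verified Lean document; each statement's English description precedes it below -/
import Mathlib

section
/- Let N ≥ 2, let r₁, …, r_N ≥ 0 be real numbers, let γ > 0 and τ ∈ ℝ. Then |F(r₁, …, r_N; γ + iτ)| ≤ 2^{N-2} ∏_{j=1}^{N-1} h_γ(r_j, r_N − τ) + 2^{N-2} ∏_{j=1}^{N-1} h_γ(r_j, r_N + τ). -/
open MeasureTheory Finset Complex

/-- `phi a t = sin(t a)/a` for `t ≥ 0` (with `phi 0 t = t` for `t ≥ 0`), and `0` for `t < 0`. -/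
noncomputable def phi (a : ℝ) (t : ℝ) : ℝ :=
  if 0 ≤ t then (if a = 0 then t else Real.sin (t * a) / a) else 0

/-- Convolution of functions on `ℝ`. -/
noncomputable def conv (f g : ℝ → ℝ) (t : ℝ) : ℝ := ∫ s : ℝ, f (t - s) * g s

/-- `iterConvPhi a k = phi (a 0) ∗ phi (a 1) ∗ ⋯ ∗ phi (a k)` (a convolution of `k+1` functions). -/
noncomputable def iterConvPhi (a : ℕ → ℝ) : ℕ → (ℝ → ℝ)
  | 0 => phi (a 0)
  | k + 1 => conv (iterConvPhi a k) (phi (a (k + 1)))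

/-- `Ffun N a σ = ∫₀^∞ (φ_{a 0} ∗ ⋯ ∗ φ_{a (N-2)})(t) cos(t · a (N-1)) e^{-σ t} dt`,
where for `N = 2` the iterated convolution is just `φ_{a 0}`. -/
noncomputable def Ffun (N : ℕ) (a : ℕ → ℝ) (σ : ℂ) : ℂ :=
  ∫ t in Set.Ioi (0 : ℝ),
    ((iterConvPhi a (N - 2) t * Real.cos (t * a (N - 1)) : ℝ) : ℂ) * Complex.exp (-σ * t)

/-- `hfun γ r s = (γ + |r-s|)⁻¹ (γ + |r+s|)⁻¹`. -/
noncomputable def hfun (γ r s : ℝ) : ℝ := (γ + |r - s|)⁻¹ * (γ + |r + s|)⁻¹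

/-- `f` has (two-sided) Laplace transform `L` at `z`, with absolute convergence. -/
def HasLT (f : ℝ → ℝ) (z L : ℂ) : Prop :=
  Integrable (fun t : ℝ => (f t : ℂ) * Complex.exp (-z * t)) ∧
    ∫ t : ℝ, (f t : ℂ) * Complex.exp (-z * t) = L

theorem HasLT.conv {f g : ℝ → ℝ} {z L M : ℂ} (hf : HasLT f z L) (hg : HasLT g z M) :
    HasLT (conv f g) z (L * M) := by
  have key : (fun t : ℝ => ((_root_.conv f g t : ℝ) : ℂ) * Complex.exp (-z * t)) =
      MeasureTheory.convolution (fun t : ℝ => (f t : ℂ) * Complex.exp (-z * t))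
        (fun t : ℝ => (g t : ℂ) * Complex.exp (-z * t)) (ContinuousLinearMap.mul ℝ ℂ) volume := by
    funext t
    rw [convolution_eq_swap]
    simp only [ContinuousLinearMap.mul_apply']
    unfold _root_.conv
    rw [← integral_complex_ofReal, ← integral_mul_const]
    congr 1
    funext s
    have : Complex.exp (-z * t) = Complex.exp (-z * ((t - s : ℝ) : ℂ)) * Complex.exp (-z * s) := by
      rw [← Complex.exp_add]; congr 1; push_cast; ring
    rw [this]; push_cast; ring
  refine ⟨?_, ?_⟩
  · rw [key]; exact hf.1.integrable_convolution _ hg.1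
  · rw [key, integral_convolution _ hf.1 hg.1, hf.2, hg.2]; rfl

theorem hasLT_of_Ioi {f : ℝ → ℝ} {z L : ℂ} (h0 : ∀ t < 0, f t = 0)
    (hi : IntegrableOn (fun t : ℝ => (f t : ℂ) * Complex.exp (-z * t)) (Set.Ioi 0))
    (hL : ∫ t in Set.Ioi (0 : ℝ), (f t : ℂ) * Complex.exp (-z * t) = L) : HasLT f z L := by
  rw [← integral_Ici_eq_integral_Ioi] at hL
  rw [← integrableOn_Ici_iff_integrableOn_Ioi] at hi
  have hz : ∀ t : ℝ, t ∉ Set.Ici (0 : ℝ) → (f t : ℂ) * Complex.exp (-z * t) = 0 := by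
    intro t ht
    simp only [Set.mem_Ici, not_le] at ht
    simp [h0 t ht]
  exact ⟨hi.integrable_of_forall_notMem_eq_zero hz,
    by rw [← hL, setIntegral_eq_integral_of_forall_compl_eq_zero hz]⟩

theorem hasLT_heaviside {z : ℂ} (hz : 0 < z.re) :
    HasLT (fun t => if 0 ≤ t then 1 else 0) z (1 / z) := by
  have hE : Set.EqOn (fun t : ℝ => Complex.exp (-z * t))
      (fun t : ℝ => (((if 0 ≤ t then 1 else 0 : ℝ)) : ℂ) * Complex.exp (-z * t))
      (Set.Ioi 0) := by
    intro t ht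
    have : (0 : ℝ) ≤ t := le_of_lt ht
    simp [this]
  have hre : (-z).re < 0 := by simpa using hz
  apply hasLT_of_Ioi
  · intro t ht; simp [ht]
  · exact (integrableOn_exp_mul_complex_Ioi hre 0).congr_fun hE measurableSet_Ioi
  · rw [← setIntegral_congr_fun measurableSet_Ioi hE, integral_exp_mul_complex_Ioi hre]
    simp [neg_div_neg_eq]

theorem phi_of_neg (a t : ℝ) (ht : t < 0) : phi a t = 0 := by
  simp [phi, ht]

theorem phi_zero_eq : phi 0 = conv (fun t => if 0 ≤ t then 1 else 0)
    (fun t => if 0 ≤ t then 1 else 0) := by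
  funext t
  have : (fun s : ℝ => (if 0 ≤ t - s then (1 : ℝ) else 0) * (if 0 ≤ s then 1 else 0)) =
      (Set.Icc 0 t).indicator (fun _ => 1) := by
    funext s
    by_cases h1 : 0 ≤ s <;> by_cases h2 : s ≤ t <;> simp [Set.indicator, h1, h2]
  unfold conv
  rw [this, integral_indicator measurableSet_Icc]
  by_cases h : 0 ≤ t
  · simp [phi, h]
  · simp [phi, h]

theorem hasLT_phi (a : ℝ) {z : ℂ} (hz : 0 < z.re) :
    HasLT (phi a) z (1 / ((z - a * I) * (z + a * I))) := by
  by_cases ha : a = 0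
  · subst ha
    rw [phi_zero_eq]
    convert (hasLT_heaviside hz).conv (hasLT_heaviside hz) using 1
    simp
  have haC : (a : ℂ) ≠ 0 := by exact_mod_cast ha
  have hE : Set.EqOn (fun t : ℝ => (1 / (2 * I * a)) * Complex.exp ((-(z - a * I)) * t) -
      (1 / (2 * I * a)) * Complex.exp ((-(z + a * I)) * t))
      (fun t : ℝ => (phi a t : ℂ) * Complex.exp (-z * t)) (Set.Ioi 0) := by
    intro t ht
    have h0 : (0 : ℝ) ≤ t := le_of_lt ht
    simp only [phi, h0, ha, if_true, if_false]
    push_cast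
    rw [Complex.sin]
    have e1 : Complex.exp ((-(z - a * I)) * t) = Complex.exp (t * a * I) * Complex.exp (-z * t) := by
      rw [← Complex.exp_add]; congr 1; ring
    have e2 : Complex.exp ((-(z + a * I)) * t) = Complex.exp (-(t * a) * I) * Complex.exp (-z * t) := by
      rw [← Complex.exp_add]; congr 1; ring
    rw [e1, e2]
    generalize Complex.exp (t * a * I) = X
    generalize Complex.exp (-(t * a) * I) = Y
    generalize Complex.exp (-z * t) = W
    field_simp
    linear_combination W * (X - Y) * I_sq
  have hr1 : (-(z - a * I)).re < 0 := by simpa using hz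
  have hr2 : (-(z + a * I)).re < 0 := by simpa using hz
  have i1 := (integrableOn_exp_mul_complex_Ioi hr1 0).const_mul (1 / (2 * I * a))
  have i2 := (integrableOn_exp_mul_complex_Ioi hr2 0).const_mul (1 / (2 * I * a))
  have n1 : z - a * I ≠ 0 := by
    intro h; rw [h] at hr1; simp at hr1
  have n2 : z + a * I ≠ 0 := by
    intro h; rw [h] at hr2; simp at hr2
  apply hasLT_of_Ioi (phi_of_neg a)
  · exact IntegrableOn.congr_fun (i1.sub i2) hE measurableSet_Ioi
  · rw [← setIntegral_congr_fun measurableSet_Ioi hE, integral_sub i1 i2, integral_const_mul,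
      integral_const_mul, integral_exp_mul_complex_Ioi hr1, integral_exp_mul_complex_Ioi hr2]
    simp only [ofReal_zero, mul_zero, Complex.exp_zero, neg_div_neg_eq]
    have h2 : (2 * I * a : ℂ) = (z + a * I) - (z - a * I) := by ring
    have h3 : (2 * I * a : ℂ) ≠ 0 := by simp [haC]
    rw [h2] at h3 ⊢
    generalize z + a * I = q at *
    generalize z - a * I = p at *
    field_simp

theorem iterConvPhi_of_neg (a : ℕ → ℝ) (k : ℕ) : ∀ t < 0, iterConvPhi a k t = 0 := by
  induction k with
  | zero => exact phi_of_neg _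
  | succ k ih =>
    intro t ht
    simp only [iterConvPhi, conv]
    rw [← integral_zero ℝ ℝ]
    congr 1
    funext s
    by_cases hs : s < 0
    · simp [phi_of_neg _ _ hs]
    · rw [ih (t - s) (by linarith)]; simp

theorem hasLT_iterConvPhi (a : ℕ → ℝ) (k : ℕ) {z : ℂ} (hz : 0 < z.re) :
    HasLT (iterConvPhi a k) z
      (∏ j ∈ Finset.range (k + 1), 1 / ((z - a j * I) * (z + a j * I))) := by
  induction k with
  | zero => simpa [iterConvPhi] using hasLT_phi (a 0) hz
  | succ k ih =>
    rw [Finset.prod_range_succ]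
    exact ih.conv (hasLT_phi _ hz)

theorem norm_lower (x y : ℝ) (hx : 0 < x) : (x + |y|) ≤ √2 * ‖(x : ℂ) + y * I‖ := by
  rw [Complex.norm_add_mul_I, ← Real.sqrt_mul (by norm_num)]
  apply Real.le_sqrt_of_sq_le
  nlinarith [sq_nonneg (x - |y|), sq_abs y]

theorem factor_bound (γ r s : ℝ) (hγ : 0 < γ) :
    ‖1 / ((((γ : ℂ) + s * I) - r * I) * (((γ : ℂ) + s * I) + r * I))‖ ≤ 2 * hfun γ r s := by
  have h1 := norm_lower γ (s - r) hγ
  have h2 := norm_lower γ (s + r) hγ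
  have e1 : ((γ : ℂ) + s * I) - r * I = γ + (s - r : ℝ) * I := by push_cast; ring
  have e2 : ((γ : ℂ) + s * I) + r * I = γ + (s + r : ℝ) * I := by push_cast; ring
  rw [e1, e2, norm_div, norm_mul, norm_one, hfun, abs_sub_comm r s, add_comm r s]
  set A := ‖(γ : ℂ) + (s - r : ℝ) * I‖
  set B := ‖(γ : ℂ) + (s + r : ℝ) * I‖
  have p1 : 0 < γ + |s - r| := by positivity
  have p2 : 0 < γ + |s + r| := by positivity
  have hA : 0 < A := by
    by_contra h
    nlinarith [Real.sqrt_nonneg 2]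
  have hB : 0 < B := by
    by_contra h
    nlinarith [Real.sqrt_nonneg 2]
  rw [← mul_inv, ← div_eq_mul_inv, div_le_div_iff₀ (by positivity) (by positivity)]
  have := mul_le_mul h1 h2 p2.le (by positivity)
  have hs : √2 * √2 = 2 := Real.mul_self_sqrt (by norm_num)
  calc _ ≤ _ := by rw [one_mul]
       _ ≤ _ := this
       _ = (√2 * √2) * (A * B) := by ring
       _ = _ := by rw [hs]

theorem prod_bound (γ s : ℝ) (r : ℕ → ℝ) (hγ : 0 < γ) (k : ℕ) :
    ‖∏ j ∈ Finset.range k, 1 / ((((γ : ℂ) + s * I) - r j * I) * (((γ : ℂ) + s * I) + r j * I))‖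
      ≤ 2 ^ k * ∏ j ∈ Finset.range k, hfun γ (r j) s := by
  rw [norm_prod]
  refine (Finset.prod_le_prod (fun _ _ => norm_nonneg _)
    (fun j _ => factor_bound γ (r j) s hγ)).trans ?_
  rw [Finset.prod_mul_distrib]
  simp

theorem hfun_neg (γ r s : ℝ) : hfun γ r (-s) = hfun γ r s := by
  unfold hfun
  rw [sub_neg_eq_add, ← sub_eq_add_neg, mul_comm]

theorem stmt_7 (N : ℕ) (hN : 2 ≤ N) (r : ℕ → ℝ) (hr : ∀ j, j < N → 0 ≤ r j)
    (γ : ℝ) (hγ : 0 < γ) (τ : ℝ) :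
    ‖Ffun N r ((γ : ℂ) + (τ : ℂ) * Complex.I)‖ ≤
      2 ^ (N - 2) * ∏ j ∈ Finset.range (N - 1), hfun γ (r j) (r (N - 1) - τ) +
      2 ^ (N - 2) * ∏ j ∈ Finset.range (N - 1), hfun γ (r j) (r (N - 1) + τ) := by
  obtain ⟨k, rfl⟩ : ∃ k, N = k + 2 := ⟨N - 2, by omega⟩
  simp only [Ffun, Nat.add_sub_cancel, show k + 2 - 1 = k + 1 by omega]
  set R := r (k + 1)
  set z1 : ℂ := (γ : ℂ) + ((τ - R : ℝ) : ℂ) * I with hz1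
  set z2 : ℂ := (γ : ℂ) + ((τ + R : ℝ) : ℂ) * I with hz2
  have l1 := hasLT_iterConvPhi r k (z := z1) (by simpa [hz1] using hγ)
  have l2 := hasLT_iterConvPhi r k (z := z2) (by simpa [hz2] using hγ)
  have key : ∀ t : ℝ, ((iterConvPhi r k t * Real.cos (t * R) : ℝ) : ℂ) *
      Complex.exp (-((γ : ℂ) + (τ : ℂ) * I) * t) =
      (1 / 2) * ((iterConvPhi r k t : ℂ) * Complex.exp (-z1 * t) +
        (iterConvPhi r k t : ℂ) * Complex.exp (-z2 * t)) := by
    intro t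
    have e1 : Complex.exp (-z1 * t) = Complex.exp (t * R * I) *
        Complex.exp (-((γ : ℂ) + (τ : ℂ) * I) * t) := by
      rw [← Complex.exp_add, hz1]; congr 1; push_cast; ring
    have e2 : Complex.exp (-z2 * t) = Complex.exp (-(t * R) * I) *
        Complex.exp (-((γ : ℂ) + (τ : ℂ) * I) * t) := by
      rw [← Complex.exp_add, hz2]; congr 1; push_cast; ring
    rw [e1, e2]
    push_cast
    rw [Complex.cos]
    ring
  rw [← integral_Ici_eq_integral_Ioi, setIntegral_eq_integral_of_forall_compl_eq_zero]
  · simp_rw [key]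
    rw [integral_const_mul, integral_add l1.1 l2.1, l1.2, l2.2]
    have b1 := prod_bound γ (τ - R) r hγ (k + 1)
    have b2 := prod_bound γ (τ + R) r hγ (k + 1)
    have hs : ∏ j ∈ Finset.range (k + 1), hfun γ (r j) (R - τ) =
        ∏ j ∈ Finset.range (k + 1), hfun γ (r j) (τ - R) := by
      refine Finset.prod_congr rfl fun j _ => ?_
      rw [← hfun_neg, neg_sub]
    rw [hs, add_comm R τ, norm_mul]
    refine (mul_le_mul_of_nonneg_left ((norm_add_le _ _).trans (add_le_add b1 b2))
      (norm_nonneg _)).trans (le_of_eq ?_)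
    rw [pow_succ]
    norm_num
    ring
  · intro t ht
    simp only [Set.mem_Ici, not_le] at ht
    simp [iterConvPhi_of_neg r k t ht]
end

section
/- For every C₀ > 0 there exists C > 0 (independent of N and γ) such that the following holds: for every integer N ≥ 2, every smooth function χ : ℝ → ℝ with χ(t) = 1 for |t| ≤ 1, χ(t) = 0 for |t| > 2, and |χ^{(k)}(t)| ≤ C₀^k N^k for all t ∈ ℝ and 0 ≤ k ≤ 2N + 2, and all real numbers r₁, …, r_N ≥ 0 and γ > 0, one has |∫₀^∞ (φ_{r₁} ∗ ⋯ ∗ φ_{r_{N-1}})(t) cos(t r_N) χ(t) dt| ≤ C^N N^{2N+1} γ^{-(2N+1)} e^{2γ} ∏_{j=1}^{N-1} h_γ(r_j, r_N). -/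
open MeasureTheory Finset

noncomputable def Sfun (a t : ℝ) : ℝ := if a = 0 then t else Real.sin (t * a) / a

lemma phi_eq (a t : ℝ) : phi a t = (Set.Ioi (0:ℝ)).indicator (Sfun a) t := by
  unfold phi Sfun Set.indicator
  simp only [Set.mem_Ioi]
  rcases lt_trichotomy t 0 with h | h | h
  · simp [not_le.2 h, not_lt.2 h.le]
  · subst h; simp
  · simp [h, h.le]

lemma Sfun_abs_le (a t : ℝ) : |Sfun a t| ≤ |t| := by
  unfold Sfun
  split_ifs with h
  · exact le_rfl
  · rw [abs_div, div_le_iff₀ (abs_pos.2 h), ← abs_mul]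
    exact Real.abs_sin_le_abs

lemma Sfun_hasDerivAt (a t : ℝ) : HasDerivAt (Sfun a) (Real.cos (t * a)) t := by
  by_cases h : a = 0
  · subst h
    have : Sfun 0 = id := by ext t; simp [Sfun]
    rw [this]; simpa using hasDerivAt_id t
  · have : Sfun a = fun t => Real.sin (t * a) / a := by ext t; simp [Sfun, h]
    rw [this]
    have := ((hasDerivAt_mul_const (x := t) a).sin).div_const a
    exact this.congr_deriv (mul_div_cancel_right₀ _ h)

lemma cos_hasDerivAt (a t : ℝ) :
    HasDerivAt (fun t => Real.cos (t * a)) (-(a^2 * Sfun a t)) t := by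
  have := ((hasDerivAt_mul_const (x := t) a).cos)
  convert this using 1
  unfold Sfun
  split_ifs with h
  · simp [h]
  · field_simp

lemma Sfun_zero (a : ℝ) : Sfun a 0 = 0 := by simp [Sfun]

lemma norm_cexp_neg (z : ℂ) (t : ℝ) : ‖Complex.exp (-z * t)‖ = Real.exp (-(z.re * t)) := by
  rw [Complex.norm_exp]; simp

lemma den_eq (z : ℂ) (a : ℝ) :
    z ^ 2 + (a:ℂ) ^ 2 = (z + a * Complex.I) * (z - a * Complex.I) := by
  linear_combination ((a:ℂ) ^ 2) * Complex.I_sq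

lemma den_ne (z : ℂ) (hz : 0 < z.re) (a : ℝ) : z ^ 2 + (a:ℂ) ^ 2 ≠ 0 := by
  rw [den_eq]
  refine mul_ne_zero ?_ ?_
  · intro h; have := congrArg Complex.re h; simp at this; linarith
  · intro h; have := congrArg Complex.re h; simp at this; linarith

lemma laplace_phi (a : ℝ) (z : ℂ) (hz : 0 < z.re) :
    Integrable (fun t : ℝ => (phi a t : ℂ) * Complex.exp (-z * t)) ∧
    ∫ t : ℝ, (phi a t : ℂ) * Complex.exp (-z * t) = (z ^ 2 + (a:ℂ) ^ 2)⁻¹ := by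
  have e : (fun t : ℝ => (phi a t : ℂ) * Complex.exp (-z * t)) =
      (Set.Ioi (0:ℝ)).indicator (fun t : ℝ => (Sfun a t : ℂ) * Complex.exp (-z * t)) := by
    ext t
    rw [phi_eq]
    by_cases h : t ∈ Set.Ioi (0:ℝ) <;> simp [h]
  have hcont : Continuous (Sfun a) :=
    continuous_iff_continuousAt.2 fun t => (Sfun_hasDerivAt a t).continuousAt
  have hIntg : IntegrableOn (fun t : ℝ => (Sfun a t : ℂ) * Complex.exp (-z * t)) (Set.Ioi 0) := by
    have h1 := integrableOn_rpow_mul_exp_neg_mul_rpow (p := 1) (s := 1) (by norm_num)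
      (by norm_num) hz
    refine Integrable.mono' h1 (Continuous.aestronglyMeasurable (by fun_prop)) ?_
    refine (ae_restrict_iff' measurableSet_Ioi).2 (Filter.Eventually.of_forall fun t ht => ?_)
    have ht : 0 < t := ht
    rw [norm_mul, norm_cexp_neg, Complex.norm_real, Real.norm_eq_abs]
    simp only [Real.rpow_one, neg_mul]
    gcongr
    exact (Sfun_abs_le a t).trans (abs_of_pos ht).le
  rw [e]
  refine ⟨(integrable_indicator_iff measurableSet_Ioi).2 hIntg, ?_⟩
  rw [integral_indicator measurableSet_Ioi]
  have hne := den_ne z hz a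
  have hd : ∀ t ∈ Set.Ici (0:ℝ), HasDerivAt
      (fun t : ℝ => -(z ^ 2 + (a:ℂ) ^ 2)⁻¹ * (((Real.cos (t * a) : ℝ) : ℂ) + z * (Sfun a t : ℂ)) *
        Complex.exp (-z * t)) ((Sfun a t : ℂ) * Complex.exp (-z * t)) t := by
    intro t _
    have hexp : HasDerivAt (fun t : ℝ => Complex.exp (-z * t)) (Complex.exp (-z * t) * (-z)) t := by
      have : HasDerivAt (fun t : ℝ => -z * (t:ℂ)) (-z) t := by
        simpa using (Complex.ofRealCLM.hasDerivAt (x := t)).const_mul (-z)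
      exact this.cexp
    have h1 := (((cos_hasDerivAt a t).ofReal_comp.add
      ((Sfun_hasDerivAt a t).ofReal_comp.const_mul z)).const_mul
        (-(z ^ 2 + (a:ℂ) ^ 2)⁻¹)).mul hexp
    refine h1.congr_deriv ?_
    simp only [Pi.add_apply]
    field_simp
    push_cast
    ring
  have hlim : Filter.Tendsto
      (fun t : ℝ => -(z ^ 2 + (a:ℂ) ^ 2)⁻¹ * (((Real.cos (t * a) : ℝ) : ℂ) + z * (Sfun a t : ℂ)) *
        Complex.exp (-z * t)) Filter.atTop (nhds 0) := by
    have h0 : Filter.Tendsto (fun t : ℝ => Real.exp (-(z.re * t))) Filter.atTop (nhds 0) := by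
      refine Real.tendsto_exp_neg_atTop_nhds_zero.comp ?_
      exact Filter.tendsto_id.const_mul_atTop hz
    have h1 : Filter.Tendsto (fun t : ℝ => t * Real.exp (-(z.re * t))) Filter.atTop (nhds 0) := by
      have := tendsto_rpow_mul_exp_neg_mul_atTop_nhds_zero 1 z.re hz
      simpa using this
    have h2 : Filter.Tendsto (fun t : ℝ => ‖(z ^ 2 + (a:ℂ) ^ 2)⁻¹‖ *
        (Real.exp (-(z.re * t)) + ‖z‖ * (t * Real.exp (-(z.re * t))))) Filter.atTop (nhds 0) := by
      simpa using (h0.add (h1.const_mul ‖z‖)).const_mul (‖(z ^ 2 + (a:ℂ) ^ 2)⁻¹‖)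
    refine squeeze_zero_norm' ?_ h2
    filter_upwards [Filter.eventually_ge_atTop 0] with t ht
    rw [norm_mul, norm_mul, norm_cexp_neg, norm_neg, mul_assoc]
    gcongr
    have : ‖((Real.cos (t * a) : ℝ) : ℂ) + z * (Sfun a t : ℂ)‖ ≤ 1 + ‖z‖ * t := by
      refine (norm_add_le _ _).trans ?_
      rw [norm_mul, Complex.norm_real, Complex.norm_real]
      gcongr
      · exact Real.abs_cos_le_one _
      · exact (Sfun_abs_le a t).trans (abs_of_nonneg ht).le
    calc _ ≤ (1 + ‖z‖ * t) * Real.exp (-(z.re * t)) := by gcongr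
      _ = _ := by ring
  rw [integral_Ioi_of_hasDerivAt_of_tendsto' hd hIntg hlim]
  simp [Sfun_zero]

lemma laplace_iter (r : ℕ → ℝ) (z : ℂ) (hz : 0 < z.re) (k : ℕ) :
    Integrable (fun t : ℝ => (iterConvPhi r k t : ℂ) * Complex.exp (-z * t)) ∧
    ∫ t : ℝ, (iterConvPhi r k t : ℂ) * Complex.exp (-z * t) =
      ∏ j ∈ Finset.range (k+1), (z ^ 2 + (r j:ℂ) ^ 2)⁻¹ := by
  induction k with
  | zero => simpa [iterConvPhi] using laplace_phi (r 0) z hz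
  | succ k ih =>
    have hp := laplace_phi (r (k+1)) z hz
    have e : (fun t : ℝ => (iterConvPhi r (k+1) t : ℂ) * Complex.exp (-z * t)) =
      convolution (fun t : ℝ => (phi (r (k+1)) t : ℂ) * Complex.exp (-z * t))
        (fun t : ℝ => (iterConvPhi r k t : ℂ) * Complex.exp (-z * t))
        (ContinuousLinearMap.mul ℝ ℂ) volume := by
      ext t
      rw [convolution_def]
      simp only [iterConvPhi, conv, ContinuousLinearMap.mul_apply']
      rw [← integral_complex_ofReal, ← integral_mul_const]
      congr 1
      ext s
      have : Complex.exp (-z * t) = Complex.exp (-z * s) * Complex.exp (-z * ((t - s : ℝ) : ℂ)) := by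
        rw [← Complex.exp_add]; congr 1; push_cast; ring
      rw [this]; push_cast; ring
    rw [e]
    refine ⟨hp.1.integrable_convolution _ ih.1, ?_⟩
    rw [integral_convolution _ hp.1 ih.1, hp.2, ih.2, Finset.prod_range_succ _ (k+1)]
    simp [mul_comm]

lemma iter_neg (r : ℕ → ℝ) (k : ℕ) : ∀ t < 0, iterConvPhi r k t = 0 := by
  induction k with
  | zero => intro t ht; simp [iterConvPhi, phi, not_le.2 ht]
  | succ k ih =>
    intro t ht
    simp only [iterConvPhi, conv]
    rw [← integral_zero ℝ ℝ]
    congr 1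
    ext s
    by_cases hs : 0 ≤ s
    · rw [ih (t - s) (by linarith)]; simp
    · simp [phi, hs]

lemma key_bound (γ v y : ℝ) (hγ : 0 < γ) :
    γ * (γ + |y|) ≤ 2 * (Real.sqrt (γ^2+v^2) * Real.sqrt (γ^2 + (y-v)^2)) := by
  rw [← Real.sqrt_mul (by positivity)]
  have h1 : γ * γ ≤ Real.sqrt ((γ^2+v^2) * (γ^2 + (y-v)^2)) := by
    apply Real.le_sqrt_of_sq_le
    nlinarith [mul_nonneg (sq_nonneg γ) (sq_nonneg (y-v)), mul_nonneg (sq_nonneg v) (sq_nonneg γ), mul_nonneg (sq_nonneg v) (sq_nonneg (y-v))]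
  have h2 : γ * |y| ≤ Real.sqrt ((γ^2+v^2) * (γ^2 + (y-v)^2)) := by
    apply Real.le_sqrt_of_sq_le
    rw [mul_pow, sq_abs]
    nlinarith [sq_nonneg (γ^2 - v * (y-v))]
  linarith

lemma factor_bound_s8 (γ v y : ℝ) (hγ : 0 < γ) (q : ℂ) (hq1 : q.re = γ) (hq2 : q.im ^ 2 = (y - v)^2) :
    ‖q‖⁻¹ ≤ 2 * (Real.sqrt (γ^2+v^2) / γ) * (γ + |y|)⁻¹ := by
  have hq : ‖q‖ = Real.sqrt (γ^2 + (y-v)^2) := by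
    rw [Complex.norm_def, Complex.normSq_apply, hq1, ← hq2]; ring_nf
  have h := key_bound γ v y hγ
  rw [← hq] at h
  have hpos : 0 < ‖q‖ := by rw [hq]; positivity
  have : 0 < γ + |y| := by positivity
  rw [inv_eq_one_div, div_le_iff₀ hpos]
  have e : 2 * (Real.sqrt (γ^2+v^2) / γ) * (γ + |y|)⁻¹ * ‖q‖ =
    (2 * (Real.sqrt (γ^2+v^2) * ‖q‖)) / (γ * (γ + |y|)) := by field_simp
  rw [e, le_div_iff₀ (by positivity)]
  linarith

lemma den_bound (γ v r s : ℝ) (hγ : 0 < γ) :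
    ‖(((γ : ℂ) - (s + v : ℝ) * Complex.I) ^ 2 + (r:ℂ)^2)⁻¹‖ ≤
      4 * ((γ^2+v^2) / γ^2) * hfun γ r s := by
  rw [den_eq, norm_inv, norm_mul, mul_inv]
  have h1 := factor_bound_s8 γ v (r - s) hγ (((γ : ℂ) - (s + v : ℝ) * Complex.I) + r * Complex.I)
    (by simp) (by simp; ring)
  have h2 := factor_bound_s8 γ v (-(r + s)) hγ (((γ : ℂ) - (s + v : ℝ) * Complex.I) - r * Complex.I)
    (by simp) (by simp; ring)
  rw [abs_neg] at h2
  refine (mul_le_mul h1 h2 (by positivity) (by positivity)).trans (le_of_eq ?_)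
  unfold hfun
  have h3 : Real.sqrt (γ^2+v^2) * Real.sqrt (γ^2+v^2) = γ^2+v^2 := Real.mul_self_sqrt (by positivity)
  generalize (γ + |r - s|)⁻¹ = A
  generalize (γ + |r + s|)⁻¹ = B
  generalize Real.sqrt (γ^2+v^2) = X at *
  rw [← h3]
  field_simp
  ring

section chi

lemma chi_deriv_zero (χ : ℝ → ℝ) (h0 : ∀ t : ℝ, |t| > 2 → χ t = 0) (k : ℕ) (t : ℝ) (ht : |t| > 2) :
    iteratedDeriv k χ t = 0 := by
  have : χ =ᶠ[nhds t] fun _ => (0:ℝ) := by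
    filter_upwards [(isOpen_lt continuous_const continuous_abs).mem_nhds ht] with x hx using h0 x hx
  rw [this.iteratedDeriv_eq k]
  simp

lemma chi_deriv_compact (χ : ℝ → ℝ) (h0 : ∀ t : ℝ, |t| > 2 → χ t = 0) (k : ℕ) :
    HasCompactSupport (iteratedDeriv k χ) := by
  refine HasCompactSupport.intro (isCompact_Icc (a := (-2:ℝ)) (b := 2)) fun t ht => ?_
  refine chi_deriv_zero χ h0 k t ?_
  by_contra h
  exact ht (abs_le.1 (not_lt.1 h))

lemma chi_int (χ : ℝ → ℝ) (hs : ContDiff ℝ (⊤ : ℕ∞) χ) (h0 : ∀ t : ℝ, |t| > 2 → χ t = 0) (k : ℕ)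
    (w : ℂ) : Integrable (fun t : ℝ => ((iteratedDeriv k χ t : ℝ) : ℂ) * Complex.exp (w * t)) := by
  have hc : Continuous (iteratedDeriv k χ) := hs.continuous_iteratedDeriv k (by exact_mod_cast le_top)
  refine Continuous.integrable_of_hasCompactSupport (by fun_prop) ?_
  refine HasCompactSupport.mul_right ?_
  exact (chi_deriv_compact χ h0 k).comp_left (g := fun x : ℝ => (x:ℂ)) (by simp)

lemma chi_step (χ : ℝ → ℝ) (hs : ContDiff ℝ (⊤ : ℕ∞) χ) (h0 : ∀ t : ℝ, |t| > 2 → χ t = 0) (k : ℕ)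
    (w : ℂ) : ∫ t : ℝ, ((iteratedDeriv (k+1) χ t : ℝ) : ℂ) * Complex.exp (w * t) =
      - w * ∫ t : ℝ, ((iteratedDeriv k χ t : ℝ) : ℂ) * Complex.exp (w * t) := by
  have hi1 := chi_int χ hs h0 (k+1) w
  have hi0 := chi_int χ hs h0 k w
  have hd : ∀ t : ℝ, HasDerivAt (fun t : ℝ => ((iteratedDeriv k χ t : ℝ) : ℂ) * Complex.exp (w * t))
      (((iteratedDeriv (k+1) χ t : ℝ) : ℂ) * Complex.exp (w * t) +
        w * (((iteratedDeriv k χ t : ℝ) : ℂ) * Complex.exp (w * t))) t := by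
    intro t
    have hexp : HasDerivAt (fun t : ℝ => Complex.exp (w * t)) (Complex.exp (w * t) * w) t := by
      have : HasDerivAt (fun t : ℝ => w * (t:ℂ)) w t := by
        simpa using (Complex.ofRealCLM.hasDerivAt (x := t)).const_mul w
      exact this.cexp
    have hk : HasDerivAt (iteratedDeriv k χ) (iteratedDeriv (k+1) χ t) t := by
      rw [iteratedDeriv_succ]
      exact (hs.differentiable_iteratedDeriv k (by exact_mod_cast ENat.natCast_lt_top k) t).hasDerivAt
    exact (hk.ofReal_comp.mul hexp).congr_deriv (by ring)
  have := integral_eq_zero_of_hasDerivAt_of_integrable hd (hi1.add (hi0.const_mul w)) hi0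
  rw [integral_add hi1 (hi0.const_mul w), integral_const_mul] at this
  linear_combination this

lemma chi_iter (χ : ℝ → ℝ) (hs : ContDiff ℝ (⊤ : ℕ∞) χ) (h0 : ∀ t : ℝ, |t| > 2 → χ t = 0) (k : ℕ)
    (w : ℂ) : ∫ t : ℝ, ((iteratedDeriv k χ t : ℝ) : ℂ) * Complex.exp (w * t) =
      (- w) ^ k * ∫ t : ℝ, (χ t : ℂ) * Complex.exp (w * t) := by
  induction k with
  | zero => simp
  | succ k ih => rw [chi_step χ hs h0, ih]; ring

lemma chi_bound (χ : ℝ → ℝ) (hs : ContDiff ℝ (⊤ : ℕ∞) χ) (h0 : ∀ t : ℝ, |t| > 2 → χ t = 0) (k : ℕ)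
    (w : ℂ) (hw : 0 < w.re) (B : ℝ) (hB : ∀ t, |iteratedDeriv k χ t| ≤ B) :
    ‖w‖ ^ k * ‖∫ t : ℝ, (χ t : ℂ) * Complex.exp (w * t)‖ ≤ 4 * Real.exp (2 * w.re) * B := by
  have h := chi_iter χ hs h0 k w
  have h' := congrArg norm h
  rw [norm_mul, norm_pow, norm_neg] at h'
  rw [← h']
  have hB0 : 0 ≤ B := (abs_nonneg _).trans (hB 0)
  have e : ∫ t in Set.Icc (-2:ℝ) 2, ((iteratedDeriv k χ t : ℝ) : ℂ) * Complex.exp (w * t) =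
      ∫ t : ℝ, ((iteratedDeriv k χ t : ℝ) : ℂ) * Complex.exp (w * t) := by
    refine setIntegral_eq_integral_of_forall_compl_eq_zero fun t ht => ?_
    rw [chi_deriv_zero χ h0 k t]
    · simp
    · by_contra h
      exact ht (abs_le.1 (not_lt.1 h))
  rw [← e]
  have := norm_setIntegral_le_of_norm_le_const (μ := volume) (s := Set.Icc (-2:ℝ) 2)
    (f := fun t : ℝ => ((iteratedDeriv k χ t : ℝ) : ℂ) * Complex.exp (w * t))
    (C := B * Real.exp (2 * w.re)) (by simp) (by
      intro t ht
      rw [norm_mul, Complex.norm_real, Complex.norm_exp, Real.norm_eq_abs]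
      have : (w * t).re = w.re * t := by simp
      rw [this, mul_comm w.re t]
      gcongr
      · exact hB t
      · exact ht.2)
  refine this.trans (le_of_eq ?_)
  simp only [Measure.real, Real.volume_Icc]
  norm_num
  ring

end chi

lemma inv_int (γ : ℝ) (hγ : 0 < γ) :
    Integrable (fun u : ℝ => (γ^2 + (2 * Real.pi * u)^2)⁻¹) ∧
    ∫ u : ℝ, (γ^2 + (2 * Real.pi * u)^2)⁻¹ = 1 / (2 * γ) := by
  have e : (fun u : ℝ => (γ^2 + (2 * Real.pi * u)^2)⁻¹) =
      fun u => (γ^2)⁻¹ * (1 + ((2 * Real.pi / γ) * u)^2)⁻¹ := by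
    ext u
    rw [← mul_inv]
    congr 1
    field_simp
  have hne : 2 * Real.pi / γ ≠ 0 := by positivity
  rw [e]
  refine ⟨((integrable_inv_one_add_sq.comp_mul_left' hne)).const_mul _, ?_⟩
  rw [integral_const_mul, Measure.integral_comp_mul_left (fun x : ℝ => (1 + x^2)⁻¹),
    integral_univ_inv_one_add_sq, abs_of_pos (by positivity)]
  simp only [smul_eq_mul]
  field_simp

open FourierTransform in
lemma inversion (χ : ℝ → ℝ) (hs : ContDiff ℝ (⊤ : ℕ∞) χ) (h0 : ∀ t : ℝ, |t| > 2 → χ t = 0)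
    (γ : ℝ) (hγ : 0 < γ) (B : ℝ) (hB : ∀ t, |iteratedDeriv 2 χ t| ≤ B) :
    Integrable (fun u : ℝ => ∫ t : ℝ, (χ t : ℂ) * Complex.exp ((γ - (2 * Real.pi * u : ℝ) * Complex.I) * t))
    ∧ ∀ t : ℝ, ∫ u : ℝ, Complex.exp ((2 * Real.pi * u : ℝ) * Complex.I * t) *
      (∫ t : ℝ, (χ t : ℂ) * Complex.exp ((γ - (2 * Real.pi * u : ℝ) * Complex.I) * t)) =
      (χ t : ℂ) * Complex.exp (γ * t) := by
  set g : ℝ → ℂ := fun t => (χ t : ℂ) * Complex.exp (γ * t) with hg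
  have hgi : Integrable g := by simpa using chi_int χ hs h0 0 γ
  have hχc : Continuous χ := hs.continuous
  have hgc : Continuous g := by fun_prop
  have hF : (fun u : ℝ => ∫ t : ℝ, (χ t : ℂ) *
      Complex.exp ((γ - (2 * Real.pi * u : ℝ) * Complex.I) * t)) = 𝓕 g := by
    ext u
    rw [Real.fourier_real_eq_integral_exp_smul]
    congr 1
    ext t
    simp only [hg, smul_eq_mul]
    rw [mul_left_comm, ← Complex.exp_add]
    congr 2
    push_cast
    ring
  have hFc : Continuous (𝓕 g) := by
    exact VectorFourier.fourierIntegral_continuous Real.continuous_fourierChar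
      (by fun_prop) hgi
  have hFi : Integrable (𝓕 g) := by
    refine Integrable.mono' ((inv_int γ hγ).1.const_mul (4 * Real.exp (2 * γ) * B))
      hFc.aestronglyMeasurable (Filter.Eventually.of_forall fun u => ?_)
    rw [← hF]
    have := chi_bound χ hs h0 2 (γ - (2 * Real.pi * u : ℝ) * Complex.I) (by simpa using hγ) B hB
    have hn : ‖((γ:ℂ) - (2 * Real.pi * u : ℝ) * Complex.I)‖ ^ 2 = γ^2 + (2 * Real.pi * u)^2 := by
      rw [Complex.sq_norm, Complex.normSq_apply]; simp; ring
    rw [hn] at this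
    have hre : ((γ:ℂ) - (2 * Real.pi * u : ℝ) * Complex.I).re = γ := by simp
    rw [hre] at this
    rw [← div_eq_mul_inv, le_div_iff₀ (by positivity)]
    linarith
  rw [hF]
  refine ⟨hFi, fun t => ?_⟩
  have h1 := congrFun (hgc.fourierInv_fourier_eq hgi hFi) t
  rw [Real.fourierInv_eq'] at h1
  change _ = g t
  rw [← h1]
  congr 1
  ext u
  rw [← hF]
  simp only [smul_eq_mul]
  congr 2
  simp
  ring

lemma swap (F G : ℝ → ℂ) (hF : Integrable F) (hG : Integrable G) :
    ∫ t : ℝ, F t * ∫ u : ℝ, Complex.exp ((2 * Real.pi * u : ℝ) * Complex.I * t) * G u =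
    ∫ u : ℝ, G u * ∫ t : ℝ, F t * Complex.exp ((2 * Real.pi * u : ℝ) * Complex.I * t) := by
  have hIntg : Integrable (fun p : ℝ × ℝ =>
      F p.1 * G p.2 * Complex.exp ((2 * Real.pi * p.2 : ℝ) * Complex.I * p.1))
      (volume.prod volume) := by
    refine Integrable.mul_bdd (c := 1) (hF.mul_prod hG) ?_ ?_
    · exact Continuous.aestronglyMeasurable (by fun_prop)
    · refine Filter.Eventually.of_forall fun p => ?_
      rw [Complex.norm_exp]
      simp
  have h := integral_integral_swap (f := fun t u =>
    F t * G u * Complex.exp ((2 * Real.pi * u : ℝ) * Complex.I * t)) hIntg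
  calc _ = ∫ t : ℝ, ∫ u : ℝ, F t * G u * Complex.exp ((2 * Real.pi * u : ℝ) * Complex.I * t) := by
        congr 1; ext t; rw [← integral_const_mul]; congr 1; ext u; ring
    _ = _ := h
    _ = _ := by
        congr 1; ext u; rw [← integral_const_mul]; congr 1; ext t; ring

theorem stmt_8 (C₀ : ℝ) (hC₀ : 0 < C₀) :
    ∃ C : ℝ, 0 < C ∧ ∀ N : ℕ, 2 ≤ N → ∀ χ : ℝ → ℝ,
      ContDiff ℝ (⊤ : ℕ∞) χ →
      (∀ t : ℝ, |t| ≤ 1 → χ t = 1) →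
      (∀ t : ℝ, |t| > 2 → χ t = 0) →
      (∀ k : ℕ, k ≤ 2 * N + 2 → ∀ t : ℝ, |iteratedDeriv k χ t| ≤ C₀ ^ k * (N : ℝ) ^ k) →
      ∀ r : ℕ → ℝ, (∀ j, j < N → 0 ≤ r j) → ∀ γ : ℝ, 0 < γ →
        |∫ t in Set.Ioi (0 : ℝ), iterConvPhi r (N - 2) t * Real.cos (t * r (N - 1)) * χ t| ≤
          C ^ N * (N : ℝ) ^ (2 * N + 1) * (γ ^ (2 * N + 1))⁻¹ * Real.exp (2 * γ) *
            ∏ j ∈ Finset.range (N - 1), hfun γ (r j) (r (N - 1)) := by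
  refine ⟨8 * (1 + C₀^2)^2, by positivity, ?_⟩
  intro N hN χ hs _ h0 hder r _ γ hγ
  obtain ⟨m, rfl⟩ : ∃ m, N = m + 2 := ⟨N - 2, by omega⟩
  simp only [Nat.add_sub_cancel, show m + 2 - 1 = m + 1 by omega]
  set s := r (m+1) with hsdef
  set P := ∏ j ∈ Finset.range (m + 1), hfun γ (r j) s with hP
  have hP0 : 0 ≤ P := Finset.prod_nonneg fun j _ => by unfold hfun; positivity
  set G : ℝ → ℂ := fun u : ℝ => ∫ t : ℝ, (χ t : ℂ) *
    Complex.exp ((γ - (2 * Real.pi * u : ℝ) * Complex.I) * t) with hG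
  obtain ⟨hGi, hinv⟩ := inversion χ hs h0 γ hγ _ (hder 2 (by omega))
  set f := iterConvPhi r m with hf
  set F : ℝ → ℂ := fun t => (f t : ℂ) * Complex.exp (-(γ - s * Complex.I) * t) with hFdef
  have hFi : Integrable F := (laplace_iter r (γ - s * Complex.I) (by simpa using hγ) m).1
  have hχc : Continuous χ := hs.continuous
  have hprod : ∀ t : ℝ, F t * ((χ t : ℂ) * Complex.exp (γ * t)) =
      (f t : ℂ) * Complex.exp (s * t * Complex.I) * χ t := by
    intro t
    simp only [hFdef]
    have : Complex.exp (s * t * Complex.I) =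
        Complex.exp (-(γ - s * Complex.I) * t) * Complex.exp (γ * t) := by
      rw [← Complex.exp_add]; congr 1; ring
    rw [this]; ring
  have hJi : Integrable (fun t : ℝ => F t * ((χ t : ℂ) * Complex.exp (γ * t))) := by
    have hc : Continuous (fun t : ℝ => (χ t : ℂ) * Complex.exp (γ * t)) := by fun_prop
    have hcs : HasCompactSupport (fun t : ℝ => (χ t : ℂ) * Complex.exp (γ * t)) := by
      refine HasCompactSupport.mul_right ?_
      have := chi_deriv_compact χ h0 0
      rw [iteratedDeriv_zero] at this
      exact this.comp_left (g := fun x : ℝ => (x:ℂ)) (by simp)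
    obtain ⟨c, hc'⟩ := hcs.exists_bound_of_continuous hc
    exact hFi.mul_bdd hc.aestronglyMeasurable (Filter.Eventually.of_forall hc')
  have hre : ∫ t in Set.Ioi (0 : ℝ), f t * Real.cos (t * s) * χ t =
      (∫ t : ℝ, F t * ((χ t : ℂ) * Complex.exp (γ * t))).re := by
    have e1 : ∫ t in Set.Ioi (0 : ℝ), f t * Real.cos (t * s) * χ t =
        ∫ t : ℝ, f t * Real.cos (t * s) * χ t := by
      rw [← integral_Ici_eq_integral_Ioi]
      refine setIntegral_eq_integral_of_forall_compl_eq_zero fun t ht => ?_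
      rw [hf, iter_neg r m t (by simpa using ht)]
      simp
    rw [e1]
    have := integral_re hJi
    simp only [RCLike.re_eq_complex_re] at this
    rw [← this]
    congr 1
    ext t
    rw [hprod]
    have : Complex.exp (s * t * Complex.I) = (Real.cos (t * s) : ℝ) + (Real.sin (t * s) : ℝ) * Complex.I := by
      push_cast
      rw [← Complex.exp_mul_I]; congr 2; ring
    rw [this]
    simp [Complex.mul_re, Complex.mul_im, -Complex.ofReal_cos, -Complex.ofReal_sin]
  rw [hre]
  refine (Complex.abs_re_le_norm _).trans ?_
  have hI : ∫ t : ℝ, F t * ((χ t : ℂ) * Complex.exp (γ * t)) =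
      ∫ u : ℝ, G u * ∏ j ∈ Finset.range (m+1),
        (((γ : ℂ) - (s + 2 * Real.pi * u : ℝ) * Complex.I) ^ 2 + (r j:ℂ)^2)⁻¹ := by
    calc _ = ∫ t : ℝ, F t * ∫ u : ℝ, Complex.exp ((2 * Real.pi * u : ℝ) * Complex.I * t) * G u := by
          congr 1; ext t; rw [hinv t]
      _ = _ := swap F G hFi hGi
      _ = _ := by
          congr 1; ext u; congr 1
          rw [← (laplace_iter r ((γ : ℂ) - (s + 2 * Real.pi * u : ℝ) * Complex.I)
            (by simpa using hγ) m).2]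
          congr 1; ext t
          simp only [hFdef]
          rw [mul_assoc, ← Complex.exp_add]
          congr 2
          push_cast
          ring
  rw [hI]
  set M : ℝ := ((m + 2 : ℕ) : ℝ) with hM
  have hM0 : 0 < M := by rw [hM]; positivity
  set K : ℝ := 4 * Real.exp (2 * γ) * (C₀ ^ (2 * (m+2) + 2) * M ^ (2 * (m+2) + 2)) *
    ((4 / γ^2)^(m+1) * P) * (γ^2)⁻¹ with hK
  have hbd : ∀ u : ℝ, ‖G u * ∏ j ∈ Finset.range (m+1),
        (((γ : ℂ) - (s + 2 * Real.pi * u : ℝ) * Complex.I) ^ 2 + (r j:ℂ)^2)⁻¹‖ ≤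
        K * (γ^2 + (2 * Real.pi * u)^2)⁻¹ := by
    intro u
    have h1 := chi_bound χ hs h0 (2 * (m+2) + 2) (γ - (2 * Real.pi * u : ℝ) * Complex.I)
      (by simpa using hγ) _ (hder _ le_rfl)
    have hn : ‖((γ:ℂ) - (2 * Real.pi * u : ℝ) * Complex.I)‖ ^ 2 = γ^2 + (2 * Real.pi * u)^2 := by
      rw [Complex.sq_norm, Complex.normSq_apply]; simp; ring
    have hre : ((γ:ℂ) - (2 * Real.pi * u : ℝ) * Complex.I).re = γ := by simp
    rw [show 2 * (m+2) + 2 = 2 * (m + 3) by ring, pow_mul ‖_‖, hn, hre,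
      show 2 * (m + 3) = 2 * (m+2) + 2 by ring] at h1
    set D := γ^2 + (2 * Real.pi * u)^2 with hD
    have hD0 : γ^2 ≤ D := by rw [hD]; nlinarith [sq_nonneg (2 * Real.pi * u)]
    have hDpos : 0 < D := by positivity
    have h2 : ‖∏ j ∈ Finset.range (m+1),
        (((γ : ℂ) - (s + 2 * Real.pi * u : ℝ) * Complex.I) ^ 2 + (r j:ℂ)^2)⁻¹‖ ≤
        (4 * (D / γ^2))^(m+1) * P := by
      rw [norm_prod, hP]
      have : (4 * (D / γ^2))^(m+1) = ∏ j ∈ Finset.range (m+1), (4 * (D / γ^2)) := by simp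
      rw [this, ← Finset.prod_mul_distrib]
      exact Finset.prod_le_prod (fun _ _ => norm_nonneg _)
        (fun j _ => den_bound γ (2 * Real.pi * u) (r j) s hγ)
    set L := 4 * Real.exp (2 * γ) * (C₀ ^ (2 * (m+2) + 2) * M ^ (2 * (m+2) + 2)) with hL
    have hL0 : 0 ≤ L := by positivity
    have h3 : ‖G u‖ ≤ L / D^(m+3) := by
      rw [le_div_iff₀ (by positivity), mul_comm]; exact h1
    rw [norm_mul]
    calc _ ≤ (L / D^(m+3)) * ((4 * (D / γ^2))^(m+1) * P) := by gcongr
      _ = L * ((4 / γ^2)^(m+1) * P) * D⁻¹ * D⁻¹ := by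
          rw [show 4 * (D / γ^2) = (4 / γ^2) * D by ring, mul_pow]
          field_simp
          ring
      _ ≤ L * ((4 / γ^2)^(m+1) * P) * (γ^2)⁻¹ * D⁻¹ := by gcongr
  refine (norm_integral_le_of_norm_le ((inv_int γ hγ).1.const_mul K)
    (Filter.Eventually.of_forall hbd)).trans ?_
  rw [integral_const_mul, (inv_int γ hγ).2, hK]
  have hM2 : M ≤ 2 ^ (m+2) := by
    rw [hM]; exact_mod_cast (Nat.lt_two_pow_self (n := m+2)).le
  have hC : C₀ ^ (2 * (m+2) + 2) ≤ ((1 + C₀^2)^2)^(m+2) := by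
    calc C₀ ^ (2 * (m+2) + 2) = (C₀^2)^(m+3) := by rw [← pow_mul]; ring
      _ ≤ (1 + C₀^2)^(m+3) := by gcongr; linarith
      _ ≤ (1 + C₀^2)^(2*(m+2)) := by
        apply pow_le_pow_right₀ _ (by omega)
        nlinarith [sq_nonneg C₀]
      _ = _ := by rw [pow_mul]
  calc _ = (4:ℝ)^(m+2) / 2 * C₀ ^ (2 * (m+2) + 2) * (M * M ^ (2 * (m+2) + 1)) *
        (γ ^ (2 * (m+2) + 1))⁻¹ * Real.exp (2 * γ) * P := by
        rw [div_pow, ← pow_mul]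
        field_simp
        ring
    _ ≤ (4:ℝ)^(m+2) * ((1 + C₀^2)^2)^(m+2) * (2^(m+2) * M ^ (2 * (m+2) + 1)) *
        (γ ^ (2 * (m+2) + 1))⁻¹ * Real.exp (2 * γ) * P := by
        gcongr
        exact half_le_self (by positivity)
    _ = _ := by
        rw [mul_pow, show (8:ℝ) = 4 * 2 by norm_num, mul_pow]
        ring
end
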